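/- In the net setting for distance-regular graphs with d → ∞ and Assumption (DR), suppose additionally that each Γ_λ has classical parameters (d, q, α, β) with d ≥ 3 and q ∈ ℤ, |q| ≥ 2, and suppose that the net λ ↦ q(λ) is not convergent. Then the set of accumulation points of q is of the form {ℓ, ℓ²} or {ℓ, −ℓ, ℓ²} for some integer ℓ with |ℓ| ≥ 2, where eventually α ≠ 0 whenever q ∈ {ℓ, −ℓ} and α = 0 whenever q = ℓ². Moreover, a_i/√k → 0 for every i = 1, 2, …. -/

import Mathlib

open Matrix Filter

/-- A (bundled) distance-regular graph: a finite connected simple graph of diameter `d`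
with intersection numbers `a i`, `b i`, `c i` for `0 ≤ i ≤ d`; `b 0` is the valency `k`. -/
structure DRG where
  X : Type
  fin : Fintype X
  G : SimpleGraph X
  d : ℕ
  a : ℕ → ℕ
  b : ℕ → ℕ
  c : ℕ → ℕ
  conn : G.Connected
  dist_le : ∀ x y : X, G.dist x y ≤ d
  dist_eq : ∃ x y : X, G.dist x y = d
  bd : b d = 0
  c0 : c 0 = 0
  count_c : ∀ i ≤ d, ∀ x y : X, G.dist x y = i →
      {z : X | G.Adj y z ∧ G.dist x z = i - 1}.ncard = c i
  count_a : ∀ i ≤ d, ∀ x y : X, G.dist x y = i →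
      {z : X | G.Adj y z ∧ G.dist x z = i}.ncard = a i
  count_b : ∀ i ≤ d, ∀ x y : X, G.dist x y = i →
      {z : X | G.Adj y z ∧ G.dist x z = i + 1}.ncard = b i

attribute [instance] DRG.fin

noncomputable instance (Γ : DRG) : DecidableEq Γ.X := Classical.decEq _

noncomputable instance (Γ : DRG) : DecidableRel Γ.G.Adj := fun _ _ => Classical.dec _

namespace DRG

variable (Γ : DRG)

/-- The `i`-th distance matrix (over `ℂ`). -/
noncomputable def Amat (i : ℕ) : Matrix Γ.X Γ.X ℂ :=
  Matrix.of fun x y => if Γ.G.dist x y = i then 1 else 0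

/-- The adjacency algebra `A(Γ) = span_ℂ {A_0, …, A_d}`. -/
noncomputable def adjAlg : Submodule ℂ (Matrix Γ.X Γ.X ℂ) :=
  Submodule.span ℂ {M | ∃ i ≤ Γ.d, M = Γ.Amat i}

/-- The matrix `K_t = (t^{∂(x,y)})_{x,y}` (over `ℝ`). -/
noncomputable def Kmat (t : ℝ) : Matrix Γ.X Γ.X ℝ :=
  Matrix.of fun x y => t ^ Γ.G.dist x y

/-- `t ∈ π(Γ)`, i.e. `K_t` is positive semidefinite. -/
def piMem (t : ℝ) : Prop := (Γ.Kmat t).PosSemidef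

/-- The Gibbs functional `φ_t(B) = ∑_x t^{∂(x,o)} B_{x,o}` with base vertex `o`. -/
noncomputable def gibbs (t : ℝ) (o : Γ.X) (B : Matrix Γ.X Γ.X ℂ) : ℂ :=
  ∑ x : Γ.X, (t : ℂ) ^ Γ.G.dist x o * B x o

end DRG

/-- The Gaussian binomial `[i]_q = 1 + q + ⋯ + q^{i-1}`. -/
noncomputable def gaussOne (q : ℝ) (i : ℕ) : ℝ := ∑ h ∈ Finset.range i, q ^ h

/-- `Γ` has classical parameters `(d, q, α, β)`. -/
def DRG.HasClassical (Γ : DRG) (q α β : ℝ) : Prop :=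
  (∀ i ≤ Γ.d, (Γ.b i : ℝ) = (gaussOne q Γ.d - gaussOne q i) * (β - α * gaussOne q i)) ∧
  (∀ i ≤ Γ.d, (Γ.c i : ℝ) = gaussOne q i * (1 + α * gaussOne q (i - 1)))

section Net

variable {Λ : Type*} [Preorder Λ] [IsDirected Λ (· ≤ ·)] [Nonempty Λ]

/-- The variance `Σ_t²(A) = k(1−t)(1+t+t·a₁)` as a function of the net index. -/
noncomputable def sig2 (Γ : Λ → DRG) (t : Λ → ℝ) (l : Λ) : ℝ :=
  ((Γ l).b 0 : ℝ) * (1 - t l) * (1 + t l + t l * ((Γ l).a 1 : ℝ))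

/-- `ω̄_i = c_i b_{i−1} / Σ_t²(A)`. -/
noncomputable def omegaBar (Γ : Λ → DRG) (t : Λ → ℝ) (i : ℕ) (l : Λ) : ℝ :=
  (((Γ l).c i : ℝ) * ((Γ l).b (i - 1) : ℝ)) / sig2 Γ t l

/-- `ᾱ_i = (a_{i−1} − t·k) / Σ_t(A)`. -/
noncomputable def alphaBar (Γ : Λ → DRG) (t : Λ → ℝ) (i : ℕ) (l : Λ) : ℝ :=
  (((Γ l).a (i - 1) : ℝ) - t l * ((Γ l).b 0 : ℝ)) / Real.sqrt (sig2 Γ t l)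

/-- `k_i = (b₀⋯b_{i−1})/(c₁⋯c_i)` as a real number. -/
noncomputable def kiProd (Γ : Λ → DRG) (i : ℕ) (l : Λ) : ℝ :=
  (∏ h ∈ Finset.range i, ((Γ l).b h : ℝ)) / (∏ h ∈ Finset.range i, ((Γ l).c (h + 1) : ℝ))

/-- `γ̄_i = t^i √(k_i)`. -/
noncomputable def gammaBar (Γ : Λ → DRG) (t : Λ → ℝ) (i : ℕ) (l : Λ) : ℝ :=
  t l ^ i * Real.sqrt (kiProd Γ i l)

/-- Assumption (DR): for every `i ≥ 1` the limits `ω_i = lim ω̄_i` and `α_i = lim ᾱ_i`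
exist (with prescribed values `ω i`, `αl i`) and `ω_i > 0`. -/
def AssumptionDR (Γ : Λ → DRG) (t : Λ → ℝ) (ω αl : ℕ → ℝ) : Prop :=
  ∀ i : ℕ, 1 ≤ i → 0 < ω i ∧ Tendsto (omegaBar Γ t i) atTop (nhds (ω i)) ∧
    Tendsto (alphaBar Γ t i) atTop (nhds (αl i))

end Net

namespace DRG

theorem exists_dist_eq (Γ : DRG) {i : ℕ} (hi : i ≤ Γ.d) : ∃ x y : Γ.X, Γ.G.dist x y = i := by
  obtain ⟨x, y, hxy⟩ := Γ.dist_eq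
  obtain ⟨p, hp⟩ := Γ.conn.exists_walk_length_eq_dist x y
  refine ⟨x, p.getVert i, ?_⟩
  have h1 := SimpleGraph.dist_le (p.take i)
  have h2 := SimpleGraph.dist_le (p.drop i)
  have h3 := Γ.conn.dist_triangle (u := x) (v := p.getVert i) (w := y)
  rw [SimpleGraph.Walk.take_length] at h1
  rw [SimpleGraph.Walk.drop_length] at h2
  omega

theorem a_zero (Γ : DRG) : Γ.a 0 = 0 := by
  obtain ⟨x, -, -⟩ := Γ.dist_eq
  rw [← Γ.count_a 0 (Nat.zero_le _) x x SimpleGraph.dist_self, Set.ncard_eq_zero]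
  ext z
  simp only [Set.mem_ofPred_eq, Set.mem_empty_iff_false, iff_false, not_and]
  intro h
  rw [SimpleGraph.dist_eq_one_iff_adj.mpr h]
  exact one_ne_zero

theorem ncard_adj (Γ : DRG) (y : Γ.X) : {z : Γ.X | Γ.G.Adj y z}.ncard = Γ.b 0 := by
  rw [← Γ.count_b 0 (Nat.zero_le _) y y SimpleGraph.dist_self]
  congr 1
  ext z
  simp [SimpleGraph.dist_eq_one_iff_adj]

theorem a_add_b_add_c (Γ : DRG) {i : ℕ} (hi : i ≤ Γ.d) : Γ.a i + Γ.b i + Γ.c i = Γ.b 0 := by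
  rcases Nat.eq_zero_or_pos i with rfl | hpos
  · simp [Γ.a_zero, Γ.c0]
  obtain ⟨x, y, hxy⟩ := Γ.exists_dist_eq hi
  rw [← Γ.ncard_adj y, ← Γ.count_a i hi x y hxy, ← Γ.count_b i hi x y hxy,
    ← Γ.count_c i hi x y hxy, ← Set.ncard_union_eq, ← Set.ncard_union_eq]
  · congr 1
    ext z
    simp only [Set.mem_union, Set.mem_ofPred_eq]
    constructor
    · tauto
    · intro h
      rcases h.diff_dist_adj (u := x) with h' | h' | h'
      · exact Or.inl (Or.inl ⟨h, by omega⟩)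
      · exact Or.inl (Or.inr ⟨h, by omega⟩)
      · exact Or.inr ⟨h, by omega⟩
  · rw [Set.disjoint_left]
    simp only [Set.mem_union, Set.mem_ofPred_eq]
    omega
  · rw [Set.disjoint_left]
    simp only [Set.mem_ofPred_eq]
    omega

end DRG

theorem gaussOne_zero (q : ℝ) : gaussOne q 0 = 0 := by simp [gaussOne]

theorem gaussOne_one (q : ℝ) : gaussOne q 1 = 1 := by simp [gaussOne]

theorem gaussOne_two (q : ℝ) : gaussOne q 2 = 1 + q := by simp [gaussOne, Finset.sum_range_succ]

theorem gaussOne_three (q : ℝ) : gaussOne q 3 = 1 + q + q ^ 2 := by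
  simp [gaussOne, Finset.sum_range_succ]

theorem gaussOne_four (q : ℝ) : gaussOne q 4 = 1 + q + q ^ 2 + q ^ 3 := by
  simp [gaussOne, Finset.sum_range_succ]

theorem gaussOne_succ (q : ℝ) (i : ℕ) : gaussOne q (i + 1) = 1 + q * gaussOne q i := by
  simp only [gaussOne, Finset.sum_range_succ', pow_succ', Finset.mul_sum, pow_zero]
  ring

theorem two_mul_abs_gaussOne_le {q : ℝ} (hq : 2 ≤ |q|) (i : ℕ) :
    2 * |gaussOne q i| - 1 ≤ |gaussOne q (i + 1)| := by
  have h := abs_sub_abs_le_abs_add (q * gaussOne q i) 1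
  rw [abs_mul, abs_one, add_comm, ← gaussOne_succ] at h
  nlinarith [abs_nonneg (gaussOne q i)]

theorem le_abs_gaussOne {q : ℝ} (hq : 2 ≤ |q|) (i : ℕ) : (i : ℝ) ≤ |gaussOne q (i + 1)| := by
  suffices h : (i : ℝ) ≤ |gaussOne q (i + 1)| ∧ 1 ≤ |gaussOne q (i + 1)| from h.1
  have hsq : (4 : ℝ) ≤ q ^ 2 := by rw [← sq_abs]; nlinarith
  have key : ∀ j : ℕ, (j : ℝ) + 2 ≤ |gaussOne q (j + 3)| := by
    intro j
    induction j with
    | zero =>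
      rw [zero_add, gaussOne_three]
      refine le_trans ?_ (le_abs_self _)
      have : -|q| ≤ q := neg_abs_le q
      have : q ^ 2 = |q| ^ 2 := (sq_abs q).symm
      push_cast
      nlinarith
    | succ j ih =>
      have := two_mul_abs_gaussOne_le hq (j + 3)
      have hj : (0 : ℝ) ≤ j := j.cast_nonneg
      rw [show j + 1 + 3 = j + 3 + 1 by ring]
      push_cast
      linarith
  match i with
  | 0 => simp [gaussOne_one]
  | 1 =>
    have := two_mul_abs_gaussOne_le hq 1
    simp only [gaussOne_one, abs_one] at this
    constructor <;> push_cast <;> linarith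
  | j + 2 =>
    have := key j
    have hj : (0 : ℝ) ≤ j := j.cast_nonneg
    constructor <;> push_cast <;> linarith

theorem two_mul_abs_one_add_le_abs_gaussOne {q : ℤ} (hq : 2 ≤ |q|) (i : ℕ) :
    2 * |1 + (q : ℝ)| ≤ |gaussOne q (i + 3)| := by
  have hq' : (2 : ℝ) ≤ |(q : ℝ)| := by exact_mod_cast hq
  have h1 : (1 : ℝ) ≤ |1 + (q : ℝ)| := by
    have : 1 ≤ |1 + q| := by
      rcases abs_cases q with h | h <;> rcases abs_cases (1 + q) with h' | h' <;> omega
    exact_mod_cast this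
  induction i with
  | zero =>
    rw [zero_add, gaussOne_three]
    refine le_trans ?_ (le_abs_self _)
    have : 2 * |1 + q| ≤ 1 + q + q ^ 2 := by
      rcases abs_cases q with h | h <;> rcases abs_cases (1 + q) with h' | h' <;> nlinarith
    exact_mod_cast this
  | succ i ih =>
    have := two_mul_abs_gaussOne_le hq' (i + 3)
    rw [show i + 1 + 3 = i + 3 + 1 by ring]
    linarith

namespace DRG.HasClassical

variable {Γ : DRG}

theorem c_two {q α β : ℝ} (h : Γ.HasClassical q α β) (hd : 2 ≤ Γ.d) :
    (Γ.c 2 : ℝ) = (1 + q) * (1 + α) := by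
  rw [h.2 2 hd, gaussOne_two, Nat.add_one_sub_one, gaussOne_one, mul_one]

theorem c_three {q α β : ℝ} (h : Γ.HasClassical q α β) (hd : 3 ≤ Γ.d) :
    (Γ.c 3 : ℝ) = (1 + q + q ^ 2) * (Γ.c 2 - q) := by
  rw [h.c_two (by omega), h.2 3 hd, gaussOne_three, Nat.add_one_sub_one, gaussOne_two]
  ring

theorem c_four {q α β : ℝ} (h : Γ.HasClassical q α β) (hd : 4 ≤ Γ.d) :
    (Γ.c 4 : ℝ) = (1 + q ^ 2) * (Γ.c 2 * (1 + q + q ^ 2) - q * (1 + q) ^ 2) := by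
  rw [h.c_two (by omega), h.2 4 hd, gaussOne_four, Nat.add_one_sub_one, gaussOne_three]
  ring

theorem b_zero {q α β : ℝ} (h : Γ.HasClassical q α β) : (Γ.b 0 : ℝ) = gaussOne q Γ.d * β := by
  rw [h.1 0 (Nat.zero_le _), gaussOne_zero]
  ring

theorem a_eq {q α β : ℝ} (h : Γ.HasClassical q α β) {i : ℕ} (hi : i ≤ Γ.d) :
    (Γ.a i : ℝ) =
      gaussOne q i * (β - 1 + α * (gaussOne q Γ.d - gaussOne q i - gaussOne q (i - 1))) := by
  have hsum : (Γ.a i : ℝ) + Γ.b i + Γ.c i = Γ.b 0 := by exact_mod_cast Γ.a_add_b_add_c hi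
  rw [h.b_zero, h.1 i hi, h.2 i hi] at hsum
  linear_combination hsum

theorem a_one {q α β : ℝ} (h : Γ.HasClassical q α β) (hd : 1 ≤ Γ.d) :
    (Γ.a 1 : ℝ) = β - 1 + α * (gaussOne q Γ.d - 1) := by
  rw [h.a_eq hd, gaussOne_one, Nat.sub_self, gaussOne_zero]
  ring

theorem le_b_zero {q : ℤ} {α β : ℝ} (h : Γ.HasClassical q α β) (hq : 2 ≤ |q|) (hd : 4 ≤ Γ.d) :
    Γ.d ≤ Γ.b 0 + 1 := by
  have hq' : (2 : ℝ) ≤ |(q : ℝ)| := by exact_mod_cast hq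
  have hne : (1 + q : ℤ) ≠ 0 := by
    rcases abs_cases q with h | h <;> omega
  have hne' : (1 + q : ℝ) ≠ 0 := by exact_mod_cast hne
  have hc2 := h.c_two (by omega)
  obtain ⟨e, he⟩ : ∃ e, Γ.d = e + 3 + 1 := ⟨Γ.d - 4, by omega⟩
  have hfac : 1 ≤ |1 + α * gaussOne q (e + 3)| := by
    by_cases hα : α = 0
    · simp [hα]
    have hn : (1 + q : ℝ) * α = ((Γ.c 2 - (1 + q) : ℤ) : ℝ) := by
      push_cast
      linear_combination -hc2
    have hn1 : (1 : ℝ) ≤ |(1 + q : ℝ) * α| := by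
      have h0 : ((Γ.c 2 - (1 + q) : ℤ) : ℝ) ≠ 0 := hn ▸ mul_ne_zero hne' hα
      rw [hn]
      exact_mod_cast Int.one_le_abs (by exact_mod_cast h0)
    have h2 := two_mul_abs_one_add_le_abs_gaussOne hq e
    have h3 : 2 ≤ |α * gaussOne q (e + 3)| := by
      rw [abs_mul] at hn1 ⊢
      nlinarith [abs_nonneg α]
    have h4 := abs_sub_abs_le_abs_add (α * gaussOne q (e + 3)) 1
    rw [abs_one, add_comm _ (1 : ℝ)] at h4
    linarith
  have hcd : (Γ.c Γ.d : ℝ) = gaussOne q (e + 3 + 1) * (1 + α * gaussOne q (e + 3)) := by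
    rw [h.2 _ le_rfl, he, Nat.add_sub_cancel]
  have hle : (Γ.c Γ.d : ℝ) ≤ Γ.b 0 := by
    have := Γ.a_add_b_add_c le_rfl
    exact_mod_cast (by omega : Γ.c Γ.d ≤ Γ.b 0)
  have habs : |gaussOne q (e + 3 + 1)| ≤ Γ.c Γ.d := by
    rw [← Nat.abs_cast, hcd, abs_mul]
    exact le_mul_of_one_le_right (abs_nonneg _) hfac
  have := le_abs_gaussOne hq' (e + 3)
  have : ((e + 3 : ℕ) : ℝ) ≤ Γ.b 0 := by linarith
  have : e + 3 ≤ Γ.b 0 := by exact_mod_cast this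
  omega

theorem sqrt_le_a_one {q α β : ℝ} (h : Γ.HasClassical q α β) (hd : 1 ≤ Γ.d) (hq : 0 ≤ q)
    (hα : 0 ≤ α) : 2 * √α * √(Γ.b 0) ≤ Γ.a 1 + (1 + α) := by
  have hD : 0 < gaussOne q Γ.d := by
    obtain ⟨e, he⟩ : ∃ e, Γ.d = e + 1 := ⟨Γ.d - 1, by omega⟩
    rw [he, gaussOne_succ]
    have : 0 ≤ gaussOne q e := Finset.sum_nonneg fun j _ => pow_nonneg hq j
    positivity
  have hβ : 0 ≤ β := by
    have : (0 : ℝ) ≤ gaussOne q Γ.d * β := h.b_zero ▸ Nat.cast_nonneg _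
    exact nonneg_of_mul_nonneg_right this hD
  have h1 : √α * √(Γ.b 0) = √β * √(α * gaussOne q Γ.d) := by
    rw [← Real.sqrt_mul hα, ← Real.sqrt_mul hβ, h.b_zero]
    ring_nf
  have h2 := Real.sq_sqrt hβ
  have h3 := Real.sq_sqrt (mul_nonneg hα hD.le)
  rw [h.a_one hd, mul_assoc, h1]
  nlinarith [sq_nonneg (√β - √(α * gaussOne q Γ.d))]

end DRG.HasClassical

theorem eventually_eq_of_tendsto_natCast {ι : Type*} {F : Filter ι} [F.NeBot] {f : ι → ℕ} {x : ℝ}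
    (h : Tendsto (fun l => (f l : ℝ)) F (nhds x)) : ∃ n : ℕ, (n : ℝ) = x ∧ ∀ᶠ l in F, f l = n := by
  obtain ⟨n, hn⟩ : x ∈ Set.range ((↑) : ℕ → ℝ) :=
    Nat.isClosedEmbedding_coe_real.isClosed_range.mem_of_tendsto h
      (Eventually.of_forall fun l => Set.mem_range_self _)
  refine ⟨n, hn, ?_⟩
  rw [← hn] at h
  have h' : Tendsto f F (nhds n) := Nat.isClosedEmbedding_coe_real.tendsto_nhds_iff.mpr h
  rwa [nhds_discrete, tendsto_pure] at h'

theorem mapClusterPt_discrete_iff {ι X : Type*} [TopologicalSpace X] [DiscreteTopology X]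
    {F : Filter ι} {f : ι → X} {x : X} : MapClusterPt x F f ↔ ∃ᶠ l in F, f l = x := by
  rw [mapClusterPt_iff_frequently, nhds_discrete]
  constructor
  · intro h
    exact h {x} (Filter.mem_pure.mpr rfl)
  · intro h s hs
    exact h.mono fun l hl => hl ▸ Filter.mem_pure.mp hs

theorem exists_mem_frequently_eq {ι X : Type*} {F : Filter ι} {f : ι → X} {s : Set X}
    (hs : s.Finite) (h : ∃ᶠ l in F, f l ∈ s) : ∃ x ∈ s, ∃ᶠ l in F, f l = x := by
  by_contra! hne
  refine h ?_
  have : ∀ᶠ l in F, ∀ x ∈ s, f l ≠ x := (eventually_all_finite hs).mpr fun x hx =>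
    hne x hx
  exact this.mono fun l hl hmem => hl _ hmem rfl

/-- Two distinct integers `p`, `q` sharing `c₂ = C`, `c₃` and `c₄` are related by negation or
squaring. -/
theorem related_of_c_three_eq_of_c_four_eq {p q C : ℤ} (hpq : p ≠ q)
    (h3 : (1 + p + p ^ 2) * (C - p) = (1 + q + q ^ 2) * (C - q))
    (h4 : (1 + p ^ 2) * (C * (1 + p + p ^ 2) - p * (1 + p) ^ 2) =
      (1 + q ^ 2) * (C * (1 + q + q ^ 2) - q * (1 + q) ^ 2)) :
    (p + q = 0 ∧ C = 1 + p ^ 2) ∨ (p = q ^ 2 ∧ C = 1 + q ^ 2) ∨ (q = p ^ 2 ∧ C = 1 + p ^ 2) := by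
  have hne : p - q ≠ 0 := sub_ne_zero.mpr hpq
  have e3 : (C - 1) * (p + q + 1) = p ^ 2 + p * q + q ^ 2 :=
    mul_left_cancel₀ hne (by linear_combination h3)
  have e4 : (C - 1) * (1 + 2 * (p + q) + (p ^ 2 + p * q + q ^ 2) +
      (p ^ 3 + p ^ 2 * q + p * q ^ 2 + q ^ 3)) =
      (p ^ 2 + p * q + q ^ 2) + (p ^ 3 + p ^ 2 * q + p * q ^ 2 + q ^ 3) +
        (p ^ 4 + p ^ 3 * q + p ^ 2 * q ^ 2 + p * q ^ 3 + q ^ 4) :=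
    mul_left_cancel₀ hne (by linear_combination h4)
  have hprod : (p + q) * ((p - q ^ 2) * (q - p ^ 2)) = 0 := by
    linear_combination (p + q + 1) * e4 - (1 + 2 * (p + q) + (p ^ 2 + p * q + q ^ 2) +
      (p ^ 3 + p ^ 2 * q + p * q ^ 2 + q ^ 3)) * e3
  have hpos : ∀ x : ℤ, x ^ 2 + x + 1 ≠ 0 := fun x => by nlinarith [sq_nonneg (2 * x + 1)]
  rcases mul_eq_zero.mp hprod with h | h
  · refine Or.inl ⟨h, ?_⟩
    obtain rfl : q = -p := by linarith
    linear_combination e3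
  rcases mul_eq_zero.mp h with h | h
  · obtain rfl : p = q ^ 2 := by linarith
    refine Or.inr (Or.inl ⟨rfl, ?_⟩)
    exact mul_left_cancel₀ (hpos q) (by linear_combination e3)
  · obtain rfl : q = p ^ 2 := by linarith
    refine Or.inr (Or.inr ⟨rfl, ?_⟩)
    exact mul_left_cancel₀ (hpos p) (by linear_combination e3)

namespace AssumptionDR

variable {Λ : Type*} [Preorder Λ]
  {Γ : Λ → DRG} {t : Λ → ℝ} {ω αl : ℕ → ℝ}

theorem tendsto_a_div_sqrt (hDR : AssumptionDR Γ t ω αl) (hvar : ∀ l : Λ, 0 < sig2 Γ t l)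
    (hc1 : ∀ l, (Γ l).c 1 = 1) (i : ℕ) :
    Tendsto (fun l => ((Γ l).a i : ℝ) / √((Γ l).b 0)) atTop
      (nhds ((αl (i + 1) - αl 1) / √(ω 1))) := by
  have h1 := (((hDR (i + 1) (by omega)).2.2).sub (hDR 1 le_rfl).2.2).div
    (hDR 1 le_rfl).2.1.sqrt (Real.sqrt_pos.mpr (hDR 1 le_rfl).1).ne'
  refine h1.congr fun l => ?_
  have hS := Real.sqrt_pos.mpr (hvar l)
  simp only [Pi.div_apply, alphaBar, omegaBar, hc1, (Γ l).a_zero, Nat.add_sub_cancel, Nat.sub_self,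
    Real.sqrt_div' _ (hvar l).le, Nat.cast_one, one_mul, Nat.cast_zero]
  rw [← sub_div, div_div_div_cancel_right₀ hS.ne']
  ring

theorem tendsto_b_div (hDR : AssumptionDR Γ t ω αl) (hvar : ∀ l : Λ, 0 < sig2 Γ t l)
    (hc1 : ∀ l, (Γ l).c 1 = 1) (hd : Tendsto (fun l => (Γ l).d) atTop atTop)
    (hk : Tendsto (fun l => ((Γ l).b 0 : ℝ)) atTop atTop) (i : ℕ) :
    Tendsto (fun l => ((Γ l).b i : ℝ) / (Γ l).b 0) atTop (nhds 1) ∧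
      Tendsto (fun l => ((Γ l).c (i + 1) : ℝ)) atTop (nhds (ω (i + 1) / ω 1)) := by
  have hk0 : ∀ᶠ l in atTop, (0 : ℝ) < (Γ l).b 0 := hk.eventually_gt_atTop 0
  have hc : ∀ i, Tendsto (fun l => ((Γ l).b i : ℝ) / (Γ l).b 0) atTop (nhds 1) →
      Tendsto (fun l => ((Γ l).c (i + 1) : ℝ)) atTop (nhds (ω (i + 1) / ω 1)) := by
    intro i hb
    have h1 := ((hDR (i + 1) (by omega)).2.1.div (hDR 1 le_rfl).2.1 (hDR 1 le_rfl).1.ne').div hb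
      one_ne_zero
    rw [div_one] at h1
    refine h1.congr' ?_
    filter_upwards [hk0, hb.eventually_ne one_ne_zero] with l hl hbl
    have hS := (hvar l).ne'
    have hbi : ((Γ l).b i : ℝ) ≠ 0 := fun h => hbl (by rw [h, zero_div])
    simp only [omegaBar, hc1, Nat.add_sub_cancel, Nat.sub_self, Pi.div_apply, Nat.cast_one]
    field_simp
  suffices h : Tendsto (fun l => ((Γ l).b i : ℝ) / (Γ l).b 0) atTop (nhds 1) from ⟨h, hc i h⟩
  induction i with
  | zero => exact tendsto_const_nhds.congr' (hk0.mono fun l hl => (div_self hl.ne').symm)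
  | succ i ih =>
    have h1 := (hc i ih).div_atTop hk
    have h2 := (hDR.tendsto_a_div_sqrt hvar hc1 (i + 1)).div_atTop
      (Real.tendsto_sqrt_atTop.comp hk)
    have h3 := (tendsto_const_nhds (x := (1 : ℝ))).sub (h1.add h2)
    rw [add_zero, sub_zero] at h3
    refine h3.congr' ?_
    filter_upwards [hk0, hd.eventually_ge_atTop (i + 1)] with l hl hdl
    have hsum : ((Γ l).a (i + 1) : ℝ) + (Γ l).b (i + 1) + (Γ l).c (i + 1) = (Γ l).b 0 := by
      exact_mod_cast (Γ l).a_add_b_add_c hdl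
    simp only [Function.comp_apply]
    rw [div_div, Real.mul_self_sqrt hl.le]
    field_simp
    linear_combination -hsum

theorem eventually_c_eq [IsDirected Λ (· ≤ ·)] [Nonempty Λ]
    (hDR : AssumptionDR Γ t ω αl) (hvar : ∀ l : Λ, 0 < sig2 Γ t l)
    (hc1 : ∀ l, (Γ l).c 1 = 1) (hd : Tendsto (fun l => (Γ l).d) atTop atTop)
    (hk : Tendsto (fun l => ((Γ l).b 0 : ℝ)) atTop atTop) {i : ℕ} (hi : 1 ≤ i) :
    ∃ n : ℕ, 0 < n ∧ ∀ᶠ l in atTop, (Γ l).c i = n := by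
  obtain ⟨j, rfl⟩ : ∃ j, i = j + 1 := ⟨i - 1, by omega⟩
  obtain ⟨n, hn, hev⟩ := eventually_eq_of_tendsto_natCast (hDR.tendsto_b_div hvar hc1 hd hk j).2
  refine ⟨n, ?_, hev⟩
  have : (0 : ℝ) < n := hn ▸ div_pos (hDR (j + 1) hi).1 (hDR 1 le_rfl).1
  exact_mod_cast this

end AssumptionDR

/-- Under Assumption (DR) and classical parameters, if the net `q` is not convergent,
then its set of accumulation points is `{ℓ, ℓ²}` or `{ℓ, −ℓ, ℓ²}` for some integer
`ℓ` with `|ℓ| ≥ 2`, where eventually `α ≠ 0` whenever `q ∈ {ℓ, −ℓ}` and `α = 0`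
whenever `q = ℓ²`; moreover `a_i/√k → 0` for every `i ≥ 1`. -/
theorem stmt16 {Λ : Type*} [Preorder Λ] [IsDirected Λ (· ≤ ·)] [Nonempty Λ] [Infinite Λ]
    (Γ : Λ → DRG) (t : Λ → ℝ)
    (hpi : ∀ l : Λ, (Γ l).piMem (t l))
    (hvar : ∀ l : Λ, 0 < sig2 Γ t l)
    (hd : Tendsto (fun l : Λ => (Γ l).d) atTop atTop)
    (q : Λ → ℤ) (αp βp : Λ → ℝ)
    (hd3 : ∀ l : Λ, 3 ≤ (Γ l).d)
    (hq2 : ∀ l : Λ, 2 ≤ |q l|)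
    (hcp : ∀ l : Λ, (Γ l).HasClassical ((q l : ℤ) : ℝ) (αp l) (βp l))
    (ω αl : ℕ → ℝ) (hDR : AssumptionDR Γ t ω αl)
    (hqnc : ¬ ∃ L : ℤ, Tendsto q atTop (nhds L)) :
    ∃ ℓ : ℤ, 2 ≤ |ℓ| ∧
      ({x : ℤ | MapClusterPt x atTop q} = {ℓ, ℓ ^ 2} ∨
        {x : ℤ | MapClusterPt x atTop q} = {ℓ, -ℓ, ℓ ^ 2}) ∧
      (∀ᶠ l in (atTop : Filter Λ),
        ((q l = ℓ ∨ q l = -ℓ) → αp l ≠ 0) ∧ (q l = ℓ ^ 2 → αp l = 0)) ∧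
      (∀ i : ℕ, 1 ≤ i →
        Tendsto (fun l : Λ => ((Γ l).a i : ℝ) / Real.sqrt ((Γ l).b 0)) atTop (nhds 0)) := by
  have hc1 : ∀ l, (Γ l).c 1 = 1 := fun l => by
    have := (hcp l).2 1 (by linarith [hd3 l])
    rw [gaussOne_one, Nat.sub_self, gaussOne_zero] at this
    exact_mod_cast (by linarith : ((Γ l).c 1 : ℝ) = 1)
  have hkN : Tendsto (fun l => (Γ l).b 0) atTop atTop := by
    refine tendsto_atTop.mpr fun n => ?_
    filter_upwards [hd.eventually_ge_atTop (n + 4)] with l hl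
    have := (hcp l).le_b_zero (hq2 l) (by omega)
    omega
  have hk : Tendsto (fun l => ((Γ l).b 0 : ℝ)) atTop atTop :=
    tendsto_natCast_atTop_atTop.comp hkN
  have hksqrt : Tendsto (fun l => √((Γ l).b 0 : ℝ)) atTop atTop :=
    Real.tendsto_sqrt_atTop.comp hk
  have ha := hDR.tendsto_a_div_sqrt hvar hc1
  set A : ℕ → ℝ := fun i => (αl (i + 1) - αl 1) / √(ω 1)
  obtain ⟨C₂, -, hC₂⟩ := hDR.eventually_c_eq hvar hc1 hd hk (i := 2) (by norm_num)
  obtain ⟨C₃, hC₃pos, hC₃⟩ := hDR.eventually_c_eq hvar hc1 hd hk (i := 3) (by norm_num)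
  obtain ⟨C₄, -, hC₄⟩ := hDR.eventually_c_eq hvar hc1 hd hk (i := 4) (by norm_num)
  have hev : ∀ᶠ l in atTop, (1 + (q l : ℝ)) * (1 + αp l) = C₂ ∧
      (1 + q l + q l ^ 2) * ((C₂ : ℤ) - q l) = C₃ ∧
      (1 + q l ^ 2) * (C₂ * (1 + q l + q l ^ 2) - q l * (1 + q l) ^ 2) = C₄ := by
    filter_upwards [hC₂, hC₃, hC₄, hd.eventually_ge_atTop 4] with l h2 h3 h4 hdl
    have e2 := (hcp l).c_two (by omega)
    have e3 := (hcp l).c_three (by omega)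
    have e4 := (hcp l).c_four hdl
    rw [h2] at e2 e3 e4
    rw [h3] at e3
    rw [h4] at e4
    exact ⟨e2.symm, by exact_mod_cast e3.symm, by exact_mod_cast e4.symm⟩
  have hbdd : ∀ᶠ l in atTop, q l ∈ Set.Icc (-(C₃ : ℤ)) C₃ := by
    filter_upwards [hev] with l hl
    have hle : 1 + q l + q l ^ 2 ≤ C₃ :=
      Int.le_of_dvd (by exact_mod_cast hC₃pos) (Dvd.intro _ hl.2.1)
    constructor <;> nlinarith [sq_nonneg (q l + 1), sq_nonneg (q l)]
  have hval : ∀ {x : ℤ}, (∃ᶠ l in atTop, q l = x) → 2 ≤ |x| ∧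
      (1 + x + x ^ 2) * ((C₂ : ℤ) - x) = C₃ ∧
      (1 + x ^ 2) * (C₂ * (1 + x + x ^ 2) - x * (1 + x) ^ 2) = C₄ := by
    intro x hx
    obtain ⟨l, rfl, hl⟩ := (hx.and_eventually hev).exists
    exact ⟨hq2 l, hl.2⟩
  obtain ⟨p, -, hp⟩ := exists_mem_frequently_eq (Set.finite_Icc _ _) hbdd.frequently
  obtain ⟨r, hr, hrp⟩ : ∃ r, (∃ᶠ l in atTop, q l = r) ∧ r ≠ p := by
    have hfr : ∃ᶠ l in atTop, q l ≠ p := fun h => hqnc ⟨p, by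
      rw [nhds_discrete, tendsto_pure]
      exact h.mono fun l hl => not_not.mp hl⟩
    obtain ⟨r, hr, hr'⟩ := exists_mem_frequently_eq
      ((Set.finite_Icc (-(C₃ : ℤ)) C₃).subset (Set.sdiff_subset (t := {p})))
      ((hfr.and_eventually hbdd).mono fun l hl => ⟨hl.2, hl.1⟩)
    exact ⟨r, hr', hr.2⟩
  have hA2 : ∀ {x : ℤ}, (∃ᶠ l in atTop, q l = x) → ∀ i, A i = gaussOne x i * A 1 := by
    intro x hx i
    have hne : (atTop ⊓ 𝓟 {l | q l = x}).NeBot := frequently_mem_iff_neBot.mp hx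
    have hx1 : (1 + x : ℝ) ≠ 0 := by
      have h2 := (hval hx).1
      have : (1 + x : ℤ) ≠ 0 := by rcases abs_cases x with h | h <;> omega
      exact_mod_cast this
    have hlim : Tendsto (fun l => gaussOne x i * (((Γ l).a 1 : ℝ) / √((Γ l).b 0) -
        (C₂ / (1 + x) - 1) * (gaussOne x i + gaussOne x (i - 1) - 1) / √((Γ l).b 0)))
        (atTop ⊓ 𝓟 {l | q l = x}) (nhds (gaussOne x i * (A 1 - 0))) :=
      (((ha 1).sub (tendsto_const_nhds.div_atTop hksqrt)).const_mul _).mono_left inf_le_left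
    rw [sub_zero] at hlim
    refine tendsto_nhds_unique ((ha i).mono_left inf_le_left) (hlim.congr' ?_)
    have h1 : ∀ᶠ l in atTop ⊓ 𝓟 {l | q l = x}, q l = x :=
      mem_inf_of_right (mem_principal_self _)
    filter_upwards [h1, (hev.filter_mono inf_le_left),
      (hd.eventually_ge_atTop (i + 1)).filter_mono inf_le_left] with l hql hl hdl
    have hα : (C₂ : ℝ) / (1 + x) - 1 = αp l := by
      rw [← hl.1, hql]
      field_simp
      ring
    rw [hα, (hcp l).a_one (by omega), (hcp l).a_eq (by omega), hql]
    ring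
  have hA1 : A 1 = 0 := by
    have h1 := hA2 hp 2
    rw [hA2 hr 2, gaussOne_two, gaussOne_two] at h1
    have h2 : ((r : ℝ) - p) ≠ 0 := sub_ne_zero.mpr (by exact_mod_cast hrp)
    exact (mul_eq_zero.mp (by linear_combination h1 : ((r : ℝ) - p) * A 1 = 0)).resolve_left h2
  have hneg : ∀ {x : ℤ}, (∃ᶠ l in atTop, q l = x) → (C₂ : ℤ) = 1 + x ^ 2 → x < 0 := by
    intro x hx hC
    by_contra! hx0
    have hx2 : 2 ≤ x := by
      have := (hval hx).1
      rwa [abs_of_nonneg hx0] at this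
    have hx2' : (2 : ℝ) ≤ x := by exact_mod_cast hx2
    have hC' : (C₂ : ℝ) = 1 + (x : ℝ) ^ 2 := by exact_mod_cast hC
    set α : ℝ := C₂ / (1 + x) - 1 with hαdef
    have hα : 0 < α := by
      rw [hαdef, sub_pos, lt_div_iff₀ (by linarith), hC']
      nlinarith
    have hlim : Tendsto (fun l => ((Γ l).a 1 : ℝ) / √((Γ l).b 0) + (1 + α) / √((Γ l).b 0))
        atTop (nhds (A 1 + 0)) := (ha 1).add (tendsto_const_nhds.div_atTop hksqrt)
    rw [hA1, add_zero] at hlim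
    have hα' : 0 < 2 * √α := by positivity
    obtain ⟨l, hql, hl, hlt, hkl⟩ := (hx.and_eventually (hev.and
      ((hlim.eventually_lt_const hα').and (hksqrt.eventually_gt_atTop 0)))).exists
    have hαl : α = αp l := by
      rw [hαdef, ← hl.1, hql]
      field_simp
      ring
    have hle := (hcp l).sqrt_le_a_one (by linarith [hd3 l]) (by rw [hql]; linarith)
      (hαl ▸ hα.le)
    rw [← hαl] at hle
    rw [← add_div, div_lt_iff₀ hkl] at hlt
    linarith
  have hrel : ∀ {x y : ℤ}, (∃ᶠ l in atTop, q l = x) → (∃ᶠ l in atTop, q l = y) → x ≠ y →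
      (x = y ^ 2 ∧ y < 0 ∧ (C₂ : ℤ) = 1 + y ^ 2) ∨
        (y = x ^ 2 ∧ x < 0 ∧ (C₂ : ℤ) = 1 + x ^ 2) := by
    intro x y hx hy hxy
    have vx := (hval hx).2
    have vy := (hval hy).2
    rcases related_of_c_three_eq_of_c_four_eq hxy (vx.1.trans vy.1.symm)
      (vx.2.trans vy.2.symm) with ⟨h, hC⟩ | ⟨h, hC⟩ | ⟨h, hC⟩
    · have h1 := hneg hx hC
      have h2 := hneg hy (by rw [hC, eq_neg_of_add_eq_zero_left h, neg_sq])
      omega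
    · exact Or.inl ⟨h, hneg hy hC, hC⟩
    · exact Or.inr ⟨h, hneg hx hC, hC⟩
  obtain ⟨ℓ, hℓ, hℓsq, hℓneg, hC⟩ : ∃ ℓ : ℤ, (∃ᶠ l in atTop, q l = ℓ) ∧
      (∃ᶠ l in atTop, q l = ℓ ^ 2) ∧ ℓ < 0 ∧ (C₂ : ℤ) = 1 + ℓ ^ 2 := by
    rcases hrel hp hr hrp.symm with ⟨h, h0, hC⟩ | ⟨h, h0, hC⟩
    · exact ⟨r, hr, h ▸ hp, h0, hC⟩
    · exact ⟨p, hp, h ▸ hr, h0, hC⟩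
  have hℓ2 := (hval hℓ).1
  refine ⟨ℓ, hℓ2, Or.inl ?_, ?_, fun i _ => ?_⟩
  · ext x
    simp only [Set.mem_ofPred_eq, mapClusterPt_discrete_iff, Set.mem_insert_iff,
      Set.mem_singleton_iff]
    constructor
    · intro hx
      by_contra! hne
      rcases hrel hx hℓ hne.1 with h | h
      · exact hne.2 h.1
      · nlinarith [h.1, sq_nonneg x]
    · rintro (rfl | rfl)
      · exact hℓ
      · exact hℓsq
  · have hCR : (C₂ : ℝ) = 1 + (ℓ : ℝ) ^ 2 := by exact_mod_cast hC
    filter_upwards [hev] with l hl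
    constructor
    · intro hql hα
      have h1 := hl.1
      rw [hα, hCR] at h1
      have h2 : q l = ℓ ^ 2 := by
        have : (q l : ℝ) = (ℓ : ℝ) ^ 2 := by linarith
        exact_mod_cast this
      rw [abs_of_neg hℓneg] at hℓ2
      rcases hql with h | h <;> nlinarith
    · intro hql
      have h1 := hl.1
      rw [hCR, hql] at h1
      push_cast at h1
      have h2 : (1 + (ℓ : ℝ) ^ 2) ≠ 0 := by positivity
      exact (mul_eq_zero.mp (by linear_combination h1 :
        (1 + (ℓ : ℝ) ^ 2) * αp l = 0)).resolve_left h2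
  · have := ha i
    rwa [show (αl (i + 1) - αl 1) / √(ω 1) = 0 from (hA2 hℓ i).trans (by rw [hA1, mul_zero])]
      at this
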